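/- arXiv:1809.01440 — 2 statements merged into one kernel-verified Lean document; each statement's English description precedes it below -/
import Mathlib

section
/- Let ℓ be a prime, M a finite free Z_ℓ-module with a symmetric Z_ℓ-valued bilinear form, Γ a group acting on M preserving the form, and L ⊆ M a Γ-submodule on which the restricted form has discriminant d ≠ 0. Then for every positive integer n, the image of the natural map (M/ℓ^n)^Γ → ((M/L)/ℓ^n)^Γ contains d·((M/L)/ℓ^n)^Γ. -/
noncomputable def gramDet (R : Type) (S : Type) {M : Type} [CommRing R] [AddCommGroup M]
    [Module R M] [Module.Free R M] [Module.Finite R M] [CommRing S] (B : M → M → S) : S :=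
  letI := Classical.decEq (Module.Free.ChooseBasisIndex R M)
  Matrix.det (Matrix.of fun i j => B (Module.Free.chooseBasis R M i) (Module.Free.chooseBasis R M j))

/-- The submodule `c • M` of a module `M`, realised as the range of scalar multiplication. -/
def smulSub {R M : Type} [CommRing R] [AddCommGroup M] [Module R M] (c : R) : Submodule R M :=
  LinearMap.range (c • (LinearMap.id : M →ₗ[R] M))

section OrthogonalProjection

variable {R M : Type} [CommRing R] [AddCommGroup M] [Module R M]
  (B : M →ₗ[R] M →ₗ[R] R) (L : Submodule R M) [Module.Free R L] [Module.Finite R L]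

/-- The orthogonal projection onto `L`, multiplied by the discriminant of `L`, is integral. -/
theorem exists_scaled_orthogonal_projection :
    ∃ p : M →ₗ[R] L, ∀ (x : M) (y : L),
      B (p x) y = gramDet R R (fun x y : L => B x y) * B x y := by
  classical
  let b := Module.Free.chooseBasis R L
  let G : Matrix _ _ R := Matrix.of fun i j => B (b i) (b j)
  have hG : gramDet R R (fun x y : L => B x y) = G.det := by
    unfold gramDet
    convert rfl
  refine ⟨Fintype.linearCombination R b ∘ₗ G.adjugate.vecMulLinear ∘ₗ
    LinearMap.pi fun j => B.flip (b j), fun x y => ?_⟩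
  rw [hG]
  generalize hp : Fintype.linearCombination R b ∘ₗ G.adjugate.vecMulLinear ∘ₗ
    LinearMap.pi (fun j => B.flip (b j)) = p
  have key : B (p x) ∘ₗ L.subtype = G.det • (B x ∘ₗ L.subtype) := by
    refine b.ext fun k => ?_
    let v := fun j => B x (b j)
    have h : B (p x) (b k) = Matrix.vecMul (Matrix.vecMul v G.adjugate) G k := by
      subst hp
      simp [Fintype.linearCombination_apply, Matrix.vecMul, dotProduct, G, v]
    simp only [LinearMap.comp_apply, Submodule.subtype_apply, LinearMap.smul_apply]
    rw [h, Matrix.vecMul_vecMul, Matrix.adjugate_mul, Matrix.vecMul_smul, Matrix.vecMul_one]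
    rfl
  exact LinearMap.congr_fun key y

theorem eq_of_forall_apply_eq [IsDomain R] (hd : gramDet R R (fun x y : L => B x y) ≠ 0)
    {x y : L} (h : ∀ z : L, B x z = B y z) : x = y := by
  classical
  let b := Module.Free.chooseBasis R L
  let G : Matrix _ _ R := Matrix.of fun i j => B (b i) (b j)
  have hG : gramDet R R (fun x y : L => B x y) = G.det := by
    unfold gramDet
    convert rfl
  have hc : ⇑(b.repr (x - y)) = 0 := by
    refine Matrix.eq_zero_of_vecMul_eq_zero (hG ▸ hd) (funext fun k => ?_)
    have hxy : B (x - y : L) (b k) = 0 := by simp [h]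
    generalize x - y = u at hxy ⊢
    rw [← b.sum_repr u] at hxy
    simpa [-Module.Basis.sum_repr, Matrix.vecMul, dotProduct, G] using hxy
  rw [← sub_eq_zero, ← b.repr.map_eq_zero_iff]
  exact DFunLike.coe_injective hc

end OrthogonalProjection

/-- let `ℓ` be a prime, `M` a finite free `ℤ_ℓ`-module with a symmetric
`ℤ_ℓ`-valued bilinear form preserved by a group `Γ`, and `L ⊆ M` a `Γ`-submodule on which the
restricted form has discriminant `d ≠ 0`. Then for every `n ≥ 1` the image of the natural map
`(M/ℓⁿ)^Γ → ((M/L)/ℓⁿ)^Γ` contains `d·((M/L)/ℓⁿ)^Γ`.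
(An element of `((M/L)/ℓⁿ)^Γ` is represented by `m : M` with `ρ γ m - m ∈ L + ℓⁿM` for all `γ`;
the claim is that `d•m` agrees mod `L + ℓⁿM` with some `m'` which is `Γ`-invariant mod `ℓⁿM`.) -/
theorem stmt3 (ℓ : ℕ) [Fact ℓ.Prime]
    (M : Type) [AddCommGroup M] [Module ℤ_[ℓ] M] [Module.Free ℤ_[ℓ] M] [Module.Finite ℤ_[ℓ] M]
    (hrank : 0 < Module.finrank ℤ_[ℓ] M)
    (B : M →ₗ[ℤ_[ℓ]] M →ₗ[ℤ_[ℓ]] ℤ_[ℓ]) (hsymm : ∀ x y, B x y = B y x)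
    (Γ : Type) [Group Γ] (ρ : Γ →* (M ≃ₗ[ℤ_[ℓ]] M))
    (hρ : ∀ (γ : Γ) (x y : M), B (ρ γ x) (ρ γ y) = B x y)
    (L : Submodule ℤ_[ℓ] M) (hL : ∀ γ : Γ, L.map (ρ γ).toLinearMap ≤ L)
    (d : ℤ_[ℓ]) (hd : d = gramDet ℤ_[ℓ] ℤ_[ℓ] (fun x y : L => B x y)) (hd0 : d ≠ 0) :
    ∀ n : ℕ, 0 < n →
    ∀ m : M, (∀ γ : Γ, ρ γ m - m ∈ L ⊔ smulSub ((ℓ : ℤ_[ℓ]) ^ n)) →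
      ∃ m' : M, (∀ γ : Γ, ρ γ m' - m' ∈ (smulSub ((ℓ : ℤ_[ℓ]) ^ n) : Submodule ℤ_[ℓ] M)) ∧
        d • m - m' ∈ L ⊔ smulSub ((ℓ : ℤ_[ℓ]) ^ n) := by
  intro n _ m hm
  obtain ⟨p, hp⟩ := exists_scaled_orthogonal_projection B L
  simp only [← hd] at hp
  have hmem : ∀ (γ : Γ) (y : M), y ∈ L → ρ γ y ∈ L := fun γ y hy => hL γ ⟨y, hy, rfl⟩
  have hinv : ∀ (γ : Γ) (y : M), ρ γ (ρ γ⁻¹ y) = y := fun γ y => by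
    rw [← LinearEquiv.mul_apply, ← map_mul, mul_inv_cancel, map_one]; rfl
  have hequiv : ∀ (γ : Γ) (x : M), (p (ρ γ x) : M) = ρ γ (p x) := fun γ x => by
    refine congrArg Subtype.val (eq_of_forall_apply_eq B L (hd ▸ hd0)
      (x := p (ρ γ x)) (y := ⟨ρ γ (p x), hmem γ _ (p x).2⟩) fun z => ?_)
    have hz : B (ρ γ (p x)) z = B (p x) (ρ γ⁻¹ z) := by
      rw [← hρ γ (p x), hinv]
    have hz' : B (ρ γ x) z = B x (ρ γ⁻¹ z) := by
      rw [← hρ γ x, hinv]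
    rw [hp, hz, hz']
    exact (hp x ⟨ρ γ⁻¹ z, hmem _ _ z.2⟩).symm
  have hpL : ∀ y : L, (p y : M) = d • (y : M) := fun y =>
    congrArg Subtype.val (eq_of_forall_apply_eq B L (hd ▸ hd0)
      (x := p y) (y := d • y) fun z => by simp [hp])
  refine ⟨d • m - p m, fun γ => ?_, ?_⟩
  · obtain ⟨y, hy, _, ⟨w, rfl⟩, hyw⟩ := Submodule.mem_sup.mp (hm γ)
    refine ⟨d • w - p w, ?_⟩
    have hγ : ρ γ m = m + (y + (ℓ : ℤ_[ℓ]) ^ n • w) := by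
      rw [← sub_eq_iff_eq_add', ← hyw]
      rfl
    have hpy := hpL ⟨y, hy⟩
    simp only at hpy
    rw [map_sub (ρ γ), map_smul (ρ γ), ← hequiv, hγ]
    simp only [map_add, map_smul, Submodule.coe_add, Submodule.coe_smul, hpy,
      LinearMap.smul_apply, LinearMap.id_apply]
    module
  · rw [sub_sub_cancel]
    exact Submodule.mem_sup_left (p m).2
end

section
/- Let ℓ be a prime and Λ an order in a semisimple Q_ℓ-algebra. Then ℓ does not divide the discriminant of Λ (with respect to the reduced trace form) if and only if Λ is isomorphic as a Z_ℓ-algebra to a finite direct sum of matrix algebras Mat_{n_i}(O_{k_i}) where each O_{k_i} is the ring of integers of a finite unramified field extension k_i/Q_ℓ. -/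
open scoped TensorProduct

/-- `t : B → K` is the (relative) reduced trace of the finite-dimensional separable
semisimple `K`-algebra `B`: after base change to an algebraic closure, `B` becomes a finite
product of matrix algebras and `t` is computed by the sum of the matrix traces. -/
def IsReducedTrace (K : Type) [Field K] (B : Type) [Ring B] [Algebra K B]
    (t : B →ₗ[K] K) : Prop :=
  ∃ (m : ℕ) (n : Fin m → ℕ)
    (e : (AlgebraicClosure K ⊗[K] B) ≃ₐ[AlgebraicClosure K]
      ((i : Fin m) → Matrix (Fin (n i)) (Fin (n i)) (AlgebraicClosure K))),
    ∀ x : B, algebraMap K (AlgebraicClosure K) (t x)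
      = ∑ i, Matrix.trace (e ((1 : AlgebraicClosure K) ⊗ₜ[K] x) i)

open TensorProduct

/-- `σ` is a separability element of the `R`-algebra `M`: it is central in the bimodule `M ⊗[R] M`
and multiplies to one. -/
def IsSeparabilityElement (R : Type*) {M : Type*} [CommRing R] [Ring M] [Algebra R M]
    (σ : M ⊗[R] M) : Prop :=
  (∀ x : M, TensorProduct.map (LinearMap.mulLeft R x) LinearMap.id σ =
    TensorProduct.map LinearMap.id (LinearMap.mulRight R x) σ) ∧ LinearMap.mul' R M σ = 1

theorem exists_isSeparabilityElement_of_formallyUnramified (R S : Type*) [CommRing R] [CommRing S]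
    [Algebra R S] [Algebra.FormallyUnramified R S] [Algebra.EssFiniteType R S] :
    ∃ σ : S ⊗[R] S, IsSeparabilityElement R σ := by
  refine ⟨Algebra.FormallyUnramified.elem R S, fun x => ?_, Algebra.FormallyUnramified.lmul_elem⟩
  have h := Algebra.FormallyUnramified.one_tmul_mul_elem (R := R) x
  have h1 : ∀ τ : S ⊗[R] S, TensorProduct.map (LinearMap.mulLeft R x) LinearMap.id τ =
      (x ⊗ₜ 1) * τ := fun τ => by
    induction τ with
    | zero => simp
    | tmul a b => simp
    | add a b ha hb => rw [map_add, ha, hb, mul_add]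
  have h2 : ∀ τ : S ⊗[R] S, TensorProduct.map LinearMap.id (LinearMap.mulRight R x) τ =
      (1 ⊗ₜ x) * τ := fun τ => by
    induction τ with
    | zero => simp
    | tmul a b => simp [mul_comm]
    | add a b ha hb => rw [map_add, ha, hb, mul_add]
  rw [h1, h2, h]

theorem exists_isSeparabilityElement_matrix {R S n : Type*} [CommRing R] [Ring S]
    [Algebra R S] [Fintype n] [DecidableEq n] [Nonempty n]
    (h : ∃ σ : S ⊗[R] S, IsSeparabilityElement R σ) :
    ∃ σ : Matrix n n S ⊗[R] Matrix n n S, IsSeparabilityElement R σ := by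
  obtain ⟨σ, hσ, hσ1⟩ := h
  let o : n := Classical.arbitrary n
  refine ⟨∑ j, TensorProduct.map (Matrix.singleLinearMap R j o) (Matrix.singleLinearMap R o j) σ,
    fun x => ?_, ?_⟩
  · have h1 : ∀ j, (LinearMap.mulLeft R x) ∘ₗ Matrix.singleLinearMap R j o =
        ∑ k, Matrix.singleLinearMap R k o ∘ₗ LinearMap.mulLeft R (x k j) := by
      intro j
      ext w a b
      simp [Matrix.sum_apply, Matrix.mul_apply, Matrix.single_apply, LinearMap.sum_apply, ite_and]
    have h2 : ∀ k, (LinearMap.mulRight R x) ∘ₗ Matrix.singleLinearMap R o k =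
        ∑ j, Matrix.singleLinearMap R o j ∘ₗ LinearMap.mulRight R (x k j) := by
      intro j
      ext w a b
      simp [Matrix.sum_apply, Matrix.mul_apply, Matrix.single_apply, LinearMap.sum_apply, ite_and]
    have key : ∀ j k, TensorProduct.map (Matrix.singleLinearMap R k o ∘ₗ LinearMap.mulLeft R (x k j))
        (Matrix.singleLinearMap R o j) σ = TensorProduct.map (Matrix.singleLinearMap R k o)
        (Matrix.singleLinearMap R o j ∘ₗ LinearMap.mulRight R (x k j)) σ := by
      intro j k
      have := congrArg (TensorProduct.map (Matrix.singleLinearMap R k o)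
        (Matrix.singleLinearMap R o j)) (hσ (x k j))
      rwa [← LinearMap.comp_apply, ← LinearMap.comp_apply, ← TensorProduct.map_comp,
        ← TensorProduct.map_comp, LinearMap.comp_id, LinearMap.comp_id] at this
    simp only [map_sum, ← LinearMap.comp_apply, ← TensorProduct.map_comp, LinearMap.id_comp, h1, h2]
    simp only [← TensorProduct.mapBilinear_apply, map_sum, LinearMap.sum_apply]
    rw [Finset.sum_comm]
    simp only [TensorProduct.mapBilinear_apply, key]
  · rw [map_sum]
    have h1 : ∀ j, LinearMap.mul' R (Matrix n n S) ∘ₗ TensorProduct.map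
        (Matrix.singleLinearMap R j o) (Matrix.singleLinearMap R o j) =
        Matrix.singleLinearMap R j j ∘ₗ LinearMap.mul' R S := by
      intro j
      ext a b
      simp
    simp only [← LinearMap.comp_apply, h1]
    simp only [LinearMap.comp_apply, hσ1]
    ext a b
    simp [Matrix.sum_apply, Matrix.single_apply, Matrix.one_apply, ite_and]

theorem exists_isSeparabilityElement_pi {R ι : Type*} {S : ι → Type*} [CommRing R]
    [Fintype ι] [∀ i, Ring (S i)] [∀ i, Algebra R (S i)]
    (h : ∀ i, ∃ σ : S i ⊗[R] S i, IsSeparabilityElement R σ) :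
    ∃ σ : (∀ i, S i) ⊗[R] (∀ i, S i), IsSeparabilityElement R σ := by
  classical
  choose σ hσ hσ1 using h
  refine ⟨∑ i, TensorProduct.map (LinearMap.single R S i) (LinearMap.single R S i) (σ i),
    fun x => ?_, ?_⟩
  · have h1 : ∀ i, LinearMap.mulLeft R x ∘ₗ LinearMap.single R S i =
        LinearMap.single R S i ∘ₗ LinearMap.mulLeft R (x i) := by
      intro i
      refine LinearMap.ext fun w => ?_
      simp [Pi.single_mul_right]
    have h2 : ∀ i, LinearMap.mulRight R x ∘ₗ LinearMap.single R S i =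
        LinearMap.single R S i ∘ₗ LinearMap.mulRight R (x i) := by
      intro i
      refine LinearMap.ext fun w => ?_
      simp [Pi.single_mul_left]
    simp only [map_sum, ← LinearMap.comp_apply, ← TensorProduct.map_comp, LinearMap.id_comp, h1, h2]
    refine Finset.sum_congr rfl fun i _ => ?_
    have := congrArg (TensorProduct.map (LinearMap.single R S i) (LinearMap.single R S i))
      (hσ i (x i))
    rwa [← LinearMap.comp_apply, ← LinearMap.comp_apply, ← TensorProduct.map_comp,
        ← TensorProduct.map_comp, LinearMap.comp_id] at this
  · rw [map_sum]
    have h1 : ∀ i, LinearMap.mul' R (∀ i, S i) ∘ₗ TensorProduct.map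
        (LinearMap.single R S i) (LinearMap.single R S i) =
        LinearMap.single R S i ∘ₗ LinearMap.mul' R (S i) := by
      intro i
      refine TensorProduct.ext' fun a b => ?_
      simp [Pi.single_mul]
    simp only [← LinearMap.comp_apply, h1]
    simp only [LinearMap.comp_apply, hσ1]
    exact Finset.univ_sum_single (1 : ∀ i, S i)

section Lifting

variable {R M Λ : Type*} [CommRing R] [Ring M] [Algebra R M] [Ring Λ] [Algebra R Λ]

theorem mem_span_pow_smul_top_iff {N : Type*} [AddCommGroup N] [Module R N] {p : R} {k : ℕ}
    {x : N} : x ∈ (Ideal.span {p} ^ k • ⊤ : Submodule R N) ↔ ∃ y, x = p ^ k • y := by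
  rw [Ideal.span_singleton_pow, Submodule.ideal_span_singleton_smul,
    Submodule.mem_smul_pointwise_iff_exists]
  simp [eq_comm]

theorem mul_mem_span_pow_smul_top {p : R} {a b : ℕ} {x y : Λ}
    (hx : x ∈ (Ideal.span {p} ^ a • ⊤ : Submodule R Λ))
    (hy : y ∈ (Ideal.span {p} ^ b • ⊤ : Submodule R Λ)) :
    x * y ∈ (Ideal.span {p} ^ (a + b) • ⊤ : Submodule R Λ) := by
  rw [mem_span_pow_smul_top_iff] at *
  obtain ⟨u, rfl⟩ := hx
  obtain ⟨v, rfl⟩ := hy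
  exact ⟨u * v, by rw [smul_mul_smul_comm, pow_add]⟩

theorem mul_mem_span_pow_smul_top_left {p : R} {a : ℕ} {x : Λ} (y : Λ)
    (hx : x ∈ (Ideal.span {p} ^ a • ⊤ : Submodule R Λ)) :
    y * x ∈ (Ideal.span {p} ^ a • ⊤ : Submodule R Λ) := by
  simpa using mul_mem_span_pow_smul_top (a := 0) (x := y) (by simp) hx

theorem mul_mem_span_pow_smul_top_right {p : R} {a : ℕ} {x : Λ} (y : Λ)
    (hx : x ∈ (Ideal.span {p} ^ a • ⊤ : Submodule R Λ)) :
    x * y ∈ (Ideal.span {p} ^ a • ⊤ : Submodule R Λ) := by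
  simpa using mul_mem_span_pow_smul_top (b := 0) (y := y) hx (by simp)

/-- An approximately multiplicative map out of a separable algebra can be corrected to a map that
is multiplicative to a higher order. -/
theorem exists_mul_approx_succ {p : R} {σ : M ⊗[R] M} (hσ : IsSeparabilityElement R σ)
    {n : ℕ} (hn : 1 ≤ n) (f : M →ₗ[R] Λ)
    (hf : ∀ x y, f (x * y) - f x * f y ∈ (Ideal.span {p} ^ n • ⊤ : Submodule R Λ))
    (h1 : f 1 - 1 ∈ (Ideal.span {p} ^ 1 • ⊤ : Submodule R Λ)) :
    ∃ f' : M →ₗ[R] Λ,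
      (∀ x y, f' (x * y) - f' x * f' y ∈ (Ideal.span {p} ^ (n + 1) • ⊤ : Submodule R Λ)) ∧
      ∀ x, f' x - f x ∈ (Ideal.span {p} ^ n • ⊤ : Submodule R Λ) := by
  classical
  obtain ⟨s, rfl⟩ := TensorProduct.exists_finset σ
  let c : M →ₗ[R] M →ₗ[R] Λ := (LinearMap.mul R M).compr₂ f - (LinearMap.mul R Λ).compl₁₂ f f
  have hc : ∀ x y, c x y = f (x * y) - f x * f y := fun x y => by simp [c]
  have hcm : ∀ x y, c x y ∈ (Ideal.span {p} ^ n • ⊤ : Submodule R Λ) := fun x y => by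
    rw [hc]; exact hf x y
  have bal : ∀ x y, ∑ i ∈ s, f (x * i.1) * c i.2 y = ∑ i ∈ s, f i.1 * c (i.2 * x) y := by
    intro x y
    have := congrArg (LinearMap.mul' R Λ ∘ₗ TensorProduct.map f (c.flip y)) (hσ.1 x)
    simpa using this
  have hs1 : ∑ i ∈ s, i.1 * i.2 = 1 := by simpa using hσ.2
  let h : M →ₗ[R] Λ := ∑ i ∈ s, LinearMap.mulLeft R (f i.1) ∘ₗ c i.2
  have hh : ∀ x, h x = ∑ i ∈ s, f i.1 * c i.2 x := fun x => by simp [h, LinearMap.sum_apply]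
  have hhm : ∀ x, h x ∈ (Ideal.span {p} ^ n • ⊤ : Submodule R Λ) := fun x => by
    rw [hh]
    exact Submodule.sum_mem _ fun i _ => mul_mem_span_pow_smul_top_left _ (hcm _ _)
  refine ⟨f + h, fun x y => ?_, fun x => by simpa using hhm x⟩
  have le1 : (Ideal.span {p} ^ (n + n) • ⊤ : Submodule R Λ) ≤ Ideal.span {p} ^ (n + 1) • ⊤ :=
    Submodule.smul_mono_left (Ideal.pow_le_pow_right (by omega))
  -- the cocycle identity, averaged over the separability element
  have e1 : (∑ i ∈ s, f i.1 * f i.2) * c x y - ∑ i ∈ s, f i.1 * c (i.2 * x) y + h (x * y) -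
      h x * f y = 0 := by
    rw [hh, hh, Finset.sum_mul, Finset.sum_mul, ← Finset.sum_sub_distrib, ← Finset.sum_add_distrib,
      ← Finset.sum_sub_distrib]
    refine Finset.sum_eq_zero fun i _ => ?_
    simp only [hc, mul_assoc]
    noncomm_ring
  have e2 : (∑ i ∈ s, f (x * i.1) * c i.2 y) - f x * h y ∈
      (Ideal.span {p} ^ (n + 1) • ⊤ : Submodule R Λ) := by
    rw [hh, Finset.mul_sum, ← Finset.sum_sub_distrib]
    refine Submodule.sum_mem _ fun i _ => le1 ?_
    rw [← mul_assoc, ← sub_mul]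
    exact mul_mem_span_pow_smul_top (hf _ _) (hcm _ _)
  have e3 : (∑ i ∈ s, f i.1 * f i.2) * c x y - c x y ∈
      (Ideal.span {p} ^ (n + 1) • ⊤ : Submodule R Λ) := by
    have : (∑ i ∈ s, f i.1 * f i.2) - 1 ∈ (Ideal.span {p} ^ 1 • ⊤ : Submodule R Λ) := by
      have : (∑ i ∈ s, f i.1 * f i.2) - 1 =
          (f 1 - 1) - ∑ i ∈ s, (f (i.1 * i.2) - f i.1 * f i.2) := by
        rw [Finset.sum_sub_distrib, ← map_sum, hs1]; abel
      rw [this]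
      refine Submodule.sub_mem _ h1 (Submodule.sum_mem _ fun i _ => ?_)
      exact Submodule.smul_mono_left (Ideal.pow_le_pow_right hn) (hf _ _)
    have h3 := mul_mem_span_pow_smul_top this (hcm x y)
    rwa [sub_mul, one_mul, add_comm 1 n] at h3
  have e4 : h x * h y ∈ (Ideal.span {p} ^ (n + 1) • ⊤ : Submodule R Λ) :=
    le1 (mul_mem_span_pow_smul_top (hhm _) (hhm _))
  have : (f + h) (x * y) - (f + h) x * (f + h) y =
      ((∑ i ∈ s, f (x * i.1) * c i.2 y) - f x * h y) -
      ((∑ i ∈ s, f i.1 * f i.2) * c x y - c x y) - h x * h y := by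
    have e5 : h (x * y) = h x * f y + (∑ i ∈ s, f (x * i.1) * c i.2 y) -
        (∑ i ∈ s, f i.1 * f i.2) * c x y := by
      rw [bal, ← sub_eq_zero, ← e1]; abel
    rw [LinearMap.add_apply, e5, LinearMap.add_apply, LinearMap.add_apply, hc]
    noncomm_ring
  rw [this]
  exact Submodule.sub_mem _ (Submodule.sub_mem _ e2 e3) e4

/-- Algebra homomorphisms modulo `p` out of a separable algebra lift to a `p`-adically complete
target. -/
theorem exists_algHom_lift {p : R} [IsAdicComplete (Ideal.span {p}) Λ] {σ : M ⊗[R] M}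
    (hσ : IsSeparabilityElement R σ) (f : M →ₗ[R] Λ)
    (hf : ∀ x y, f (x * y) - f x * f y ∈ (Ideal.span {p} ^ 1 • ⊤ : Submodule R Λ))
    (h1 : f 1 - 1 ∈ (Ideal.span {p} ^ 1 • ⊤ : Submodule R Λ)) :
    ∃ g : M →ₐ[R] Λ, ∀ x, g x - f x ∈ (Ideal.span {p} ^ 1 • ⊤ : Submodule R Λ) := by
  let P : ℕ → Submodule R Λ := fun n => Ideal.span {p} ^ n • ⊤
  have anti : ∀ {m n}, m ≤ n → P n ≤ P m := fun h =>
    Submodule.smul_mono_left (Ideal.pow_le_pow_right h)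
  let A : ℕ → (M →ₗ[R] Λ) → Prop := fun n F =>
    (∀ x y, F (x * y) - F x * F y ∈ P (n + 1)) ∧ F 1 - 1 ∈ P 1
  have step : ∀ n F, A n F → ∃ F', A (n + 1) F' ∧ ∀ x, F' x - F x ∈ P (n + 1) := by
    rintro n F ⟨hF, hF1⟩
    obtain ⟨F', h, h'⟩ := exists_mul_approx_succ hσ (Nat.le_add_left 1 n) F hF hF1
    refine ⟨F', ⟨h, ?_⟩, h'⟩
    simpa using Submodule.add_mem _ (anti (Nat.le_add_left 1 n) (h' 1)) hF1
  choose! nxt hnxt hdiff using step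
  let u : ℕ → (M →ₗ[R] Λ) := fun n => Nat.rec f (fun k F => nxt k F) n
  have hu : ∀ n, A n (u n) := fun n => by
    induction n with
    | zero => exact ⟨hf, h1⟩
    | succ n ih => exact hnxt n _ ih
  have hud : ∀ n x, u (n + 1) x - u n x ∈ P (n + 1) := fun n => hdiff n _ (hu n)
  have hmn : ∀ m n, m ≤ n → ∀ x, u n x - u m x ∈ P m := by
    intro m n h x
    induction n, h using Nat.le_induction with
    | base => simp
    | succ k hk ih =>
      simpa using Submodule.add_mem _ (anti (hk.trans k.le_succ) (hud k x)) ih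
  have hlim : ∀ x, ∃ L, ∀ n, u n x - L ∈ P n := by
    intro x
    obtain ⟨L, hL⟩ := IsPrecomplete.prec (inferInstance : IsPrecomplete (Ideal.span {p}) Λ)
      (f := fun n => u n x) (fun {m n} h => by
        rw [SModEq.sub_mem, ← neg_mem_iff, neg_sub]; exact hmn m n h x)
    exact ⟨L, fun n => SModEq.sub_mem.1 (hL n)⟩
  choose L hL using hlim
  have haus : ∀ z : Λ, (∀ n, z ∈ P n) → z = 0 := fun z hz =>
    IsHausdorff.haus (inferInstance : IsHausdorff (Ideal.span {p}) Λ) z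
      fun n => SModEq.zero.2 (hz n)
  have hLu : ∀ n x, L x - u n x ∈ P n := fun n x => by
    rw [← neg_mem_iff, neg_sub]; exact hL x n
  have hadd : ∀ x y, L (x + y) = L x + L y := fun x y => by
    rw [← sub_eq_zero]
    refine haus _ fun n => ?_
    have := Submodule.sub_mem _ (hLu n (x + y)) (Submodule.add_mem _ (hLu n x) (hLu n y))
    rw [map_add] at this
    convert this using 1
    abel
  have hsmul : ∀ (r : R) x, L (r • x) = r • L x := fun r x => by
    rw [← sub_eq_zero]
    refine haus _ fun n => ?_
    have := Submodule.sub_mem _ (hLu n (r • x)) (Submodule.smul_mem _ r (hLu n x))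
    rw [map_smul, smul_sub] at this
    convert this using 1
    abel
  have hmul : ∀ x y, L (x * y) = L x * L y := fun x y => by
    rw [← sub_eq_zero]
    refine haus _ fun n => ?_
    have h2 := anti n.le_succ ((hu n).1 x y)
    have h3 := Submodule.add_mem _ (mul_mem_span_pow_smul_top_left (L x) (hLu n y))
      (mul_mem_span_pow_smul_top_right (u n y) (hLu n x))
    have := Submodule.sub_mem _ (Submodule.add_mem _ (hLu n (x * y)) h2) h3
    convert this using 1
    noncomm_ring
  have hone1 : L 1 - 1 ∈ P 1 := by
    simpa using Submodule.add_mem _ (hLu 1 1) (hu 1).2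
  have hidem : (1 - L 1) * (1 - L 1) = 1 - L 1 := by
    have := hmul 1 1
    rw [one_mul] at this
    rw [sub_mul, mul_sub, mul_sub, ← this]; simp
  have hone : L 1 = 1 := by
    rw [eq_comm, ← sub_eq_zero]
    refine haus _ fun n => ?_
    induction n with
    | zero => simp [P]
    | succ n ih =>
      rw [← hidem]
      refine mul_mem_span_pow_smul_top ih ?_
      rw [← neg_mem_iff, neg_sub]
      exact hone1
  refine ⟨AlgHom.ofLinearMap ⟨⟨L, hadd⟩, hsmul⟩ hone hmul, fun x => ?_⟩
  have := Submodule.add_mem _ (hLu 1 x) (hud 0 x)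
  rw [zero_add, sub_add_sub_cancel] at this
  exact this

end Lifting

section Complete

variable {R M Λ : Type*} [CommRing R] [Ring M] [Algebra R M] [Ring Λ] [Algebra R Λ]

theorem isAdicComplete_of_free_of_finite {N : Type*} [AddCommGroup N] [Module R N] (p : R)
    [IsAdicComplete (Ideal.span {p}) R] [Module.Free R N] [Module.Finite R N] :
    IsAdicComplete (Ideal.span {p}) N := by
  let b := Module.Free.chooseBasis R N
  have key : ∀ n (x : N), x ∈ (Ideal.span {p} ^ n • ⊤ : Submodule R N) ↔
      ∀ i, b.repr x i ∈ (Ideal.span {p} ^ n • ⊤ : Submodule R R) := by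
    intro n x
    simp only [mem_span_pow_smul_top_iff]
    constructor
    · rintro ⟨y, rfl⟩ i
      exact ⟨b.repr y i, by simp⟩
    · intro h
      choose y hy using h
      refine ⟨∑ i, y i • b i, ?_⟩
      rw [← b.sum_repr x, Finset.smul_sum]
      exact Finset.sum_congr rfl fun i _ => by rw [hy, smul_assoc]
  refine { haus' := fun x hx => ?_, prec' := fun f hf => ?_ }
  · refine b.repr.map_eq_zero_iff.1 (Finsupp.ext fun i => ?_)
    refine IsHausdorff.haus (inferInstance : IsHausdorff (Ideal.span {p}) R) _ fun n => ?_
    exact SModEq.zero.2 ((key n x).1 (SModEq.zero.1 (hx n)) i)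
  · have : ∀ i, ∃ L : R, ∀ n,
        b.repr (f n) i ≡ L [SMOD (Ideal.span {p} ^ n • ⊤ : Submodule R R)] := by
      intro i
      refine IsPrecomplete.prec (inferInstance : IsPrecomplete (Ideal.span {p}) R)
        (f := fun n => b.repr (f n) i) fun {m n} hmn => ?_
      have := (key m _).1 (SModEq.sub_mem.1 (hf hmn)) i
      rw [SModEq.sub_mem]
      simpa using this
    choose L hL using this
    refine ⟨∑ i, L i • b i, fun n => ?_⟩
    rw [SModEq.sub_mem, key]
    intro i
    have := SModEq.sub_mem.1 (hL i n)
    simpa [Finsupp.single_apply] using this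

/-- Two finite free algebras over a `p`-adically complete ring that agree modulo `p` are isomorphic
if one of them is separable. -/
theorem nonempty_algEquiv_of_mod {Q : Type*} [Ring Q] {p : R} [IsAdicComplete (Ideal.span {p}) R]
    [Module.Free R M] [Module.Finite R M] [Module.Free R Λ] [Module.Finite R Λ]
    {σ : M ⊗[R] M} (hσ : IsSeparabilityElement R σ) (hp : ∀ z : Λ, p • z = 0 → z = 0)
    (π : Λ →+* Q) (hπ : Function.Surjective π) (hπk : ∀ x, π x = 0 ↔ ∃ y, x = p • y)
    (ρ : M →+* Q) (hρ : Function.Surjective ρ) (hρk : ∀ x, ρ x = 0 ↔ ∃ y, x = p • y)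
    (h : ∀ r : R, π (algebraMap R Λ r) = ρ (algebraMap R M r)) :
    Nonempty (M ≃ₐ[R] Λ) := by
  have := isAdicComplete_of_free_of_finite (N := M) p
  have := isAdicComplete_of_free_of_finite (N := Λ) p
  have hπ1 : ∀ x, π x = 0 ↔ x ∈ (Ideal.span {p} ^ 1 • ⊤ : Submodule R Λ) := fun x => by
    rw [hπk, mem_span_pow_smul_top_iff, pow_one]
  let b := Module.Free.chooseBasis R M
  choose s hs using hπ
  let f : M →ₗ[R] Λ := b.constr R fun i => s (ρ (b i))
  have hf : ∀ x, π (f x) = ρ x := by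
    intro x
    conv_rhs => rw [← b.sum_repr x]
    rw [b.constr_apply_fintype (S := R), map_sum, map_sum]
    refine Finset.sum_congr rfl fun i _ => ?_
    rw [Algebra.smul_def, Algebra.smul_def, map_mul, map_mul, hs, h, b.equivFun_apply]
  obtain ⟨g, hg⟩ := exists_algHom_lift (p := p) hσ f (fun x y => by
    rw [← hπ1, map_sub, map_mul π, hf, hf, hf, map_mul, sub_self]) (by
    rw [← hπ1, map_sub, hf, map_one, map_one, sub_self])
  have hgρ : ∀ x, π (g x) = ρ x := fun x => by
    rw [← hf, ← sub_eq_zero, ← map_sub, hπ1]; exact hg x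
  refine ⟨AlgEquiv.ofBijective g ⟨?_, ?_⟩⟩
  · rw [injective_iff_map_eq_zero]
    intro x hx
    refine IsHausdorff.haus (inferInstance : IsHausdorff (Ideal.span {p}) M) x
      fun n => SModEq.zero.2 ?_
    induction n generalizing x with
    | zero => simp
    | succ n ih =>
      obtain ⟨y, rfl⟩ := (hρk x).1 (by rw [← hgρ, hx, map_zero])
      obtain ⟨w, rfl⟩ := mem_span_pow_smul_top_iff.1 (ih y (hp _ (by rw [← map_smul, hx])))
      exact mem_span_pow_smul_top_iff.2 ⟨w, by rw [smul_smul, pow_succ']⟩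
  · refine surjective_of_mkQ_comp_surjective (I := Ideal.span {p}) (f := g.toLinearMap) ?_
    intro q
    obtain ⟨y, rfl⟩ := Submodule.mkQ_surjective _ q
    obtain ⟨x, hx⟩ := hρ (π y)
    refine ⟨x, ?_⟩
    have : g x - y ∈ (Ideal.span {p} ^ 1 • ⊤ : Submodule R Λ) := by
      rw [← hπ1, map_sub, hgρ, hx, sub_self]
    rw [pow_one] at this
    simpa using! (Submodule.Quotient.eq _).2 this

end Complete

section Unramified

open IsLocalRing

theorem exists_isUnit_trace (R S : Type*) [CommRing R] [CommRing S] [Algebra R S] [IsLocalRing R]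
    [IsLocalRing S] [IsLocalHom (algebraMap R S)] [Module.Free R S] [Module.Finite R S]
    [Algebra.FormallyUnramified R S] : ∃ s : S, IsUnit (Algebra.trace R S s) := by
  let pS := (maximalIdeal R).map (algebraMap R S)
  let : Field (R ⧸ maximalIdeal R) := Ideal.Quotient.field _
  let : Field (S ⧸ pS) :=
    (Algebra.FormallyUnramified.isField_quotient_map_maximalIdeal (R := R) (S := S)).toField
  have : Algebra.FormallyUnramified S (S ⧸ pS) := .quotient _
  have : Algebra.FormallyUnramified R (S ⧸ pS) := .comp _ S _
  have : Algebra.FormallyUnramified (R ⧸ maximalIdeal R) (S ⧸ pS) := .of_restrictScalars R _ _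
  have : Module.Finite R (S ⧸ pS) := .trans S _
  have : Module.Finite (R ⧸ maximalIdeal R) (S ⧸ pS) := .of_restrictScalars_finite R _ _
  have : Algebra.IsSeparable (R ⧸ maximalIdeal R) (S ⧸ pS) :=
    Algebra.FormallyUnramified.isSeparable _ _
  obtain ⟨q, hq⟩ := Algebra.trace_surjective (R ⧸ maximalIdeal R) (S ⧸ pS) 1
  obtain ⟨s, rfl⟩ := Ideal.Quotient.mk_surjective q
  refine ⟨s, ?_⟩
  rw [Algebra.trace_quotient_mk] at hq
  rw [← notMem_maximalIdeal, ← Ideal.Quotient.eq_zero_iff_mem, hq]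
  exact one_ne_zero

end Unramified

section Witt

variable (ℓ : ℕ) [Fact ℓ.Prime] (k : Type) [Field k] [Algebra (ZMod ℓ) k]

/-- The `ℤ_ℓ`-algebra structure on the Witt vectors of a finite field. -/
noncomputable abbrev wittAlgebra : Algebra ℤ_[ℓ] (WittVector ℓ k) :=
  ((WittVector.map (algebraMap (ZMod ℓ) k)).comp
    (WittVector.equiv ℓ).symm.toRingHom).toAlgebra

attribute [local instance] wittAlgebra

theorem witt_algebraMap_injective : Function.Injective (algebraMap ℤ_[ℓ] (WittVector ℓ k)) :=
  (WittVector.map_injective _ (algebraMap (ZMod ℓ) k).injective).comp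
    (WittVector.equiv ℓ).symm.injective

theorem padicInt_isAdicComplete : IsAdicComplete (Ideal.span {(ℓ : ℤ_[ℓ])}) ℤ_[ℓ] := by
  rw [← PadicInt.maximalIdeal_eq_span_p]; infer_instance

attribute [local instance] padicInt_isAdicComplete

variable [Finite k] [CharP k ℓ]

theorem witt_finite : Module.Finite ℤ_[ℓ] (WittVector ℓ k) := by
  classical
  have := Fintype.ofFinite k
  let f : (k → ℤ_[ℓ]) →ₗ[ℤ_[ℓ]] WittVector ℓ k :=
    Fintype.linearCombination ℤ_[ℓ] (WittVector.teichmuller ℓ)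
  have h1 := isAdicComplete_of_free_of_finite (N := k → ℤ_[ℓ]) (ℓ : ℤ_[ℓ])
  have h2 : IsHausdorff (Ideal.span {(ℓ : ℤ_[ℓ])}) (WittVector ℓ k) := by
    rw [← IsHausdorff.map_algebraMap_iff (S := WittVector ℓ k), Ideal.map_span, Set.image_singleton,
      map_natCast]
    infer_instance
  refine Module.Finite.of_surjective f ?_
  refine surjective_of_mkQ_comp_surjective (I := Ideal.span {(ℓ : ℤ_[ℓ])}) ?_
  intro q
  obtain ⟨y, rfl⟩ := Submodule.mkQ_surjective _ q
  refine ⟨Pi.single (y.coeff 0) 1, ?_⟩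
  refine (Submodule.Quotient.eq _).2 ?_
  have := (WittVector.mem_span_p_iff_coeff_zero_eq_zero
    (WittVector.teichmuller ℓ (y.coeff 0) - y)).2 (by
      have := map_sub (WittVector.constantCoeff (p := ℓ) (R := k))
        (WittVector.teichmuller ℓ (y.coeff 0)) y
      simpa [WittVector.constantCoeff_apply] using! this)
  obtain ⟨z, hz⟩ := Ideal.mem_span_singleton.1 this
  have h3 := (mem_span_pow_smul_top_iff (R := ℤ_[ℓ]) (N := WittVector ℓ k)
    (p := (ℓ : ℤ_[ℓ])) (k := 1)).2
    ⟨z, by rw [pow_one, Algebra.smul_def, map_natCast, ← hz]⟩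
  rw [pow_one] at h3
  simpa [f, Fintype.linearCombination_apply_single] using h3

attribute [local instance] witt_finite

theorem witt_free : Module.Free ℤ_[ℓ] (WittVector ℓ k) := by
  have : FaithfulSMul ℤ_[ℓ] (WittVector ℓ k) := (faithfulSMul_iff_algebraMap_injective _ _).2
    (witt_algebraMap_injective ℓ k)
  infer_instance

attribute [local instance] witt_free

theorem witt_isLocalHom : IsLocalHom (algebraMap ℤ_[ℓ] (WittVector ℓ k)) := by
  have : FaithfulSMul ℤ_[ℓ] (WittVector ℓ k) := (faithfulSMul_iff_algebraMap_injective _ _).2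
    (witt_algebraMap_injective ℓ k)
  infer_instance

attribute [local instance] witt_isLocalHom

theorem witt_unramified : Algebra.FormallyUnramified ℤ_[ℓ] (WittVector ℓ k) := by
  have : Finite (IsLocalRing.ResidueField ℤ_[ℓ]) := inferInstance
  refine Algebra.FormallyUnramified.of_map_maximalIdeal ?_
  rw [PadicInt.maximalIdeal_eq_span_p, Ideal.map_span, Set.image_singleton, map_natCast,
    (WittVector.irreducible ℓ).maximalIdeal_eq]

end Witt

section ReducedTrace

open Polynomial

variable {ℓ : ℕ} [Fact ℓ.Prime]

theorem isIntegral_of_mem_spectrum {R Ω A : Type*} [CommRing R] [Field Ω] [Ring A] [Algebra R Ω]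
    [Algebra Ω A] [Algebra R A] [IsScalarTower R Ω A] {c : Ω} {N : ℕ}
    {z w : A} (hw : IsIntegral R w) (hzw : w = c • z ^ N) {μ : Ω} (hμ : μ ∈ spectrum Ω z) :
    IsIntegral R (c * μ ^ N) := by
  cases subsingleton_or_nontrivial A
  · simp [spectrum.of_subsingleton] at hμ
  obtain ⟨P, hP, hPw⟩ := hw
  refine ⟨P, hP, ?_⟩
  have h := spectrum.subset_polynomial_aeval z ((P.map (algebraMap R Ω)).comp (C c * X ^ N))
    ⟨μ, hμ, rfl⟩
  have h0 : aeval z ((P.map (algebraMap R Ω)).comp (C c * X ^ N)) = 0 := by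
    rw [aeval_comp]
    simp only [map_mul, aeval_C, map_pow, aeval_X, aeval_map_algebraMap]
    rw [← Algebra.smul_def, ← hzw]
    exact hPw
  rw [h0, spectrum.zero_eq, Set.mem_singleton_iff] at h
  simpa [eval₂_eq_eval_map] using h

theorem not_isIntegral_inv {Ω : Type*} [Field Ω] [Algebra ℤ_[ℓ] Ω] [Algebra ℚ_[ℓ] Ω]
    [IsScalarTower ℤ_[ℓ] ℚ_[ℓ] Ω] : ¬ IsIntegral ℤ_[ℓ] ((ℓ : Ω)⁻¹) := by
  intro h
  have h1 : IsIntegral ℤ_[ℓ] ((ℓ : ℚ_[ℓ])⁻¹) := by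
    rw [← isIntegral_algebraMap_iff (FaithfulSMul.algebraMap_injective ℚ_[ℓ] Ω)]
    simpa using h
  obtain ⟨y, hy⟩ := IsIntegrallyClosed.isIntegral_iff.1 h1
  have h2 : (ℓ : ℤ_[ℓ]) * y = 1 := by
    apply IsFractionRing.injective ℤ_[ℓ] ℚ_[ℓ]
    rw [map_mul, hy, map_natCast, map_one]
    exact mul_inv_cancel₀ (by exact_mod_cast (Fact.out : ℓ.Prime).ne_zero)
  exact PadicInt.prime_p.not_isUnit (IsUnit.of_mul_eq_one _ h2)

variable {B : Type} [Ring B] [Algebra ℚ_[ℓ] B] [Algebra ℤ_[ℓ] B] [IsScalarTower ℤ_[ℓ] ℚ_[ℓ] B]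
  {t : B →ₗ[ℚ_[ℓ]] ℚ_[ℓ]}

theorem IsReducedTrace.mul_comm {K B : Type} [Field K] [Ring B] [Algebra K B] {t : B →ₗ[K] K}
    (ht : IsReducedTrace K B t) (x y : B) : t (x * y) = t (y * x) := by
  obtain ⟨m, n, e, he⟩ := ht
  apply (algebraMap K (AlgebraicClosure K)).injective
  rw [he, he]
  refine Finset.sum_congr rfl fun i _ => ?_
  have : ∀ a b : B, e ((1 : AlgebraicClosure K) ⊗ₜ[K] (a * b)) =
      e ((1 : AlgebraicClosure K) ⊗ₜ[K] a) * e ((1 : AlgebraicClosure K) ⊗ₜ[K] b) := fun a b => by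
    rw [← map_mul, Algebra.TensorProduct.tmul_mul_tmul, one_mul]
  rw [this, this, Pi.mul_apply, Pi.mul_apply, Matrix.trace_mul_comm]

/-- The reduced trace of an element that is nilpotent modulo `ℓ` is divisible by `ℓ`. -/
theorem IsReducedTrace.dvd_of_pow_eq (ht : IsReducedTrace ℚ_[ℓ] B t) {z w : B} {N : ℕ}
    (hN : N ≠ 0) (hw : IsIntegral ℤ_[ℓ] w) (hzw : z ^ N = (ℓ : ℚ_[ℓ]) • w) {a : ℤ_[ℓ]}
    (ha : (a : ℚ_[ℓ]) = t z) : (ℓ : ℤ_[ℓ]) ∣ a := by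
  obtain ⟨m, n, e, he⟩ := ht
  let Ω := AlgebraicClosure ℚ_[ℓ]
  have hℓ : (ℓ : ℚ_[ℓ]) ≠ 0 := by exact_mod_cast (Fact.out : ℓ.Prime).ne_zero
  have hℓΩ : (ℓ : Ω) ≠ 0 := by exact_mod_cast (Fact.out : ℓ.Prime).ne_zero
  let S := integralClosure ℤ_[ℓ] Ω
  let J : Ideal S := (Ideal.span {(ℓ : S)}).radical
  have hμ : ∀ i, ∀ μ ∈ (e (1 ⊗ₜ[ℚ_[ℓ]] z) i).charpoly.roots, ∃ s ∈ J, (s : Ω) = μ := by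
    intro i μ hμ
    let φ : B →ₐ[ℤ_[ℓ]] Matrix (Fin (n i)) (Fin (n i)) Ω :=
      (((Pi.evalAlgHom Ω _ i).comp e.toAlgHom).restrictScalars ℚ_[ℓ]).comp
        Algebra.TensorProduct.includeRight |>.restrictScalars ℤ_[ℓ]
    have hφ : ∀ b, φ b = e (1 ⊗ₜ[ℚ_[ℓ]] b) i := fun b => rfl
    have hμs : μ ∈ spectrum Ω (φ z) := by
      rw [Matrix.mem_spectrum_iff_isRoot_charpoly]
      exact (Polynomial.mem_roots'.1 hμ).2
    have hwz : φ w = (ℓ : Ω)⁻¹ • (φ z) ^ N := by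
      have : w = (ℓ : ℚ_[ℓ])⁻¹ • z ^ N := by rw [hzw, inv_smul_smul₀ hℓ]
      have h2 : (ℓ : ℤ_[ℓ]) • w = z ^ N := by
        rw [hzw, ← map_natCast (algebraMap ℤ_[ℓ] ℚ_[ℓ]) ℓ, algebraMap_smul]
      rw [← map_pow, ← h2, map_smul, ← algebraMap_smul Ω (ℓ : ℤ_[ℓ]) (φ w), map_natCast,
        inv_smul_smul₀ hℓΩ]
    have hint := isIntegral_of_mem_spectrum (hw.map φ) hwz hμs
    have hℓi : IsIntegral ℤ_[ℓ] (ℓ : Ω) := by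
      simpa using isIntegral_algebraMap (R := ℤ_[ℓ]) (A := Ω) (x := (ℓ : ℤ_[ℓ]))
    have hpow : μ ^ N = (ℓ : Ω) * ((ℓ : Ω)⁻¹ * μ ^ N) := (mul_inv_cancel_left₀ hℓΩ _).symm
    have hμi : IsIntegral ℤ_[ℓ] μ := by
      refine IsIntegral.of_pow (Nat.pos_of_ne_zero hN) ?_
      rw [hpow]
      exact hℓi.mul hint
    refine ⟨⟨μ, hμi⟩, ⟨N, Ideal.mem_span_singleton.2 ⟨⟨_, hint⟩, Subtype.ext ?_⟩⟩, rfl⟩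
    simpa using hpow
  have hsum : ∃ s ∈ J, (s : Ω) = algebraMap ℚ_[ℓ] Ω (t z) := by
    rw [he]
    have h1 : ∀ i, ∃ s ∈ J, (s : Ω) = Matrix.trace (e (1 ⊗ₜ[ℚ_[ℓ]] z) i) := by
      intro i
      rw [Matrix.trace_eq_sum_roots_charpoly]
      have := hμ i
      generalize (e (1 ⊗ₜ[ℚ_[ℓ]] z) i).charpoly.roots = r at this
      induction r using Multiset.induction with
      | empty => exact ⟨0, J.zero_mem, by simp⟩
      | cons a r ih =>
        obtain ⟨s, hs, hs'⟩ := ih fun μ hμ => this μ (Multiset.mem_cons_of_mem hμ)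
        obtain ⟨s1, hs1, hs1'⟩ := this a (Multiset.mem_cons_self _ _)
        exact ⟨s1 + s, J.add_mem hs1 hs, by simp [hs', hs1']⟩
    choose s hs hs' using h1
    exact ⟨∑ i, s i, J.sum_mem fun i _ => hs i, by simp [hs']⟩
  obtain ⟨s, hs, hsa⟩ := hsum
  by_contra hdvd
  have hu : IsUnit a := by
    by_contra hnu
    refine hdvd ?_
    rw [← Ideal.mem_span_singleton, ← PadicInt.maximalIdeal_eq_span_p]
    exact hnu
  have hsa' : s = algebraMap ℤ_[ℓ] S a := Subtype.ext (by
    rw [hsa, ← ha]; exact (IsScalarTower.algebraMap_apply ℤ_[ℓ] ℚ_[ℓ] Ω a).symm)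
  have hJ : J = ⊤ := J.eq_top_of_isUnit_mem hs (hsa' ▸ hu.map _)
  rw [Ideal.radical_eq_top, Ideal.span_singleton_eq_top] at hJ
  obtain ⟨y, hy⟩ := hJ.exists_right_inv
  refine not_isIntegral_inv (ℓ := ℓ) (Ω := Ω) ?_
  have : (ℓ : Ω)⁻¹ = y := by
    refine inv_eq_of_mul_eq_one_right ?_
    simpa using congrArg (Subtype.val) hy
  rw [this]
  exact y.2

end ReducedTrace

section Gram

variable {ℓ : ℕ} [Fact ℓ.Prime]

theorem PadicInt.toZMod_eq_zero_iff (x : ℤ_[ℓ]) : PadicInt.toZMod x = 0 ↔ (ℓ : ℤ_[ℓ]) ∣ x := by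
  rw [← RingHom.mem_ker, PadicInt.ker_toZMod, PadicInt.maximalIdeal_eq_span_p,
    Ideal.mem_span_singleton]

/-- The discriminant is prime to `ℓ` iff the form is nondegenerate modulo `ℓ`. -/
theorem not_dvd_gramDet_iff {M : Type} [AddCommGroup M] [Module ℤ_[ℓ] M] [Module.Free ℤ_[ℓ] M]
    [Module.Finite ℤ_[ℓ] M] (T : M →ₗ[ℤ_[ℓ]] M →ₗ[ℤ_[ℓ]] ℤ_[ℓ]) :
    ¬ (ℓ : ℤ_[ℓ]) ∣ gramDet ℤ_[ℓ] ℤ_[ℓ] (fun x y => T x y) ↔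
      ∀ x, (∀ y, (ℓ : ℤ_[ℓ]) ∣ T x y) → ∃ y, x = (ℓ : ℤ_[ℓ]) • y := by
  classical
  let b := Module.Free.chooseBasis ℤ_[ℓ] M
  let G : Matrix _ _ ℤ_[ℓ] := Matrix.of fun i j => T (b i) (b j)
  have hG : gramDet ℤ_[ℓ] ℤ_[ℓ] (fun x y => T x y) = G.det := by
    unfold gramDet
    congr!
  let θ := PadicInt.toZMod (p := ℓ)
  have hdet : (ℓ : ℤ_[ℓ]) ∣ G.det ↔ (G.map θ).det = 0 := by
    rw [← PadicInt.toZMod_eq_zero_iff]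
    exact (RingHom.map_det θ G).symm ▸ Iff.rfl
  have hrow : ∀ (c : _ → ℤ_[ℓ]) j, θ (T (∑ i, c i • b i) (b j)) =
      Matrix.vecMul (fun i => θ (c i)) (G.map θ) j := fun c j => by
    simp [Matrix.vecMul, dotProduct, G, LinearMap.sum_apply]
  rw [hG, hdet, ← Matrix.exists_vecMul_eq_zero_iff]
  constructor
  · intro h x hx
    have h0 : (fun i => θ (b.repr x i)) = 0 := by
      by_contra hne
      refine h ⟨_, hne, funext fun j => ?_⟩
      rw [← hrow, b.sum_repr]
      exact (PadicInt.toZMod_eq_zero_iff _).2 (hx _)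
    have h1 : ∀ i, ∃ y, b.repr x i = ℓ * y := fun i =>
      (PadicInt.toZMod_eq_zero_iff _).1 (congrFun h0 i)
    choose y hy using h1
    refine ⟨∑ i, y i • b i, ?_⟩
    rw [Finset.smul_sum, ← b.sum_repr x]
    exact Finset.sum_congr rfl fun i _ => by rw [hy, mul_smul]
  · rintro h ⟨v, hv, hv0⟩
    choose c hc using fun i => ZMod.ringHom_surjective θ (v i)
    obtain ⟨y, hy⟩ := h (∑ i, c i • b i) fun z => by
      rw [← b.sum_repr z, map_sum]
      refine Finset.dvd_sum fun j _ => ?_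
      rw [map_smul]
      refine Dvd.dvd.mul_left ?_ _
      rw [← PadicInt.toZMod_eq_zero_iff]
      refine (hrow c j).trans ?_
      simp only [hc]
      exact congrFun hv0 j
    refine hv (funext fun i => ?_)
    have : c i = ℓ * b.repr y i := by
      have := congrArg (fun z => b.repr z i) hy
      simpa [Finsupp.single_apply] using this
    rw [← hc, this]
    exact (PadicInt.toZMod_eq_zero_iff _).2 (dvd_mul_right _ _)

end Gram

section Residue

variable {ℓ : ℕ} [Fact ℓ.Prime]

theorem exists_ringEquiv_galoisField (D : Type) [DivisionRing D] [Finite D]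
    (hD : (ℓ : D) = 0) : ∃ f : ℕ, 0 < f ∧ Nonempty (D ≃+* GaloisField ℓ f) := by
  let := littleWedderburn D
  have := Fintype.ofFinite D
  have : CharP D ℓ := (CharP.charP_iff_prime_eq_zero Fact.out).2 hD
  obtain ⟨n, -, hn⟩ := FiniteField.card D ℓ
  let := ZMod.algebra D ℓ
  exact ⟨n, n.pos, ⟨(GaloisField.algEquivGaloisField ℓ n
    (Nat.card_eq_fintype_card.trans hn)).toRingEquiv⟩⟩

/-- A finite Jacobson-semisimple ring of characteristic `ℓ` is a product of matrix rings over
finite fields. -/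
theorem exists_ringEquiv_pi_matrix_galoisField (A : Type) [Ring A] [Finite A]
    (hA : (ℓ : A) = 0) (hJ : Ring.jacobson A = ⊥) :
    ∃ (r : ℕ) (nn ff : Fin r → ℕ), (∀ i, 0 < nn i) ∧ (∀ i, 0 < ff i) ∧
      Nonempty (A ≃+* ((i : Fin r) → Matrix (Fin (nn i)) (Fin (nn i)) (GaloisField ℓ (ff i)))) := by
  have := IsArtinianRing.isSemisimpleRing_iff_jacobson.2 hJ
  obtain ⟨r, D, d, _, hd, ⟨e⟩⟩ := IsSemisimpleRing.exists_ringEquiv_pi_matrix_divisionRing A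
  have hsurj : ∀ i, Function.Surjective (fun a : A => e a i 0 0) := fun i x =>
    ⟨e.symm (Pi.single i (Matrix.single 0 0 x)), by simp⟩
  have hfin : ∀ i, Finite (D i) := fun i => Finite.of_surjective _ (hsurj i)
  have hchar : ∀ i, (ℓ : D i) = 0 := fun i => by
    have := congrArg (fun a => e a i 0 0) hA
    simpa [Matrix.natCast_apply] using this
  choose f hf g using fun i => exists_ringEquiv_galoisField (ℓ := ℓ) (D i) (hchar i)
  exact ⟨r, d, f, fun i => Nat.pos_of_ne_zero (hd i).ne, hf,
    ⟨e.trans (RingEquiv.piCongrRight fun i => (g i).some.mapMatrix)⟩⟩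

theorem isNilpotent_of_mem_jacobson {A : Type*} [Ring A] [IsArtinianRing A] {a : A}
    (ha : a ∈ Ring.jacobson A) : IsNilpotent a := by
  obtain ⟨n, hn⟩ := IsSemiprimaryRing.isNilpotent (R := A)
  have h := Ideal.pow_mem_pow ha n
  rw [hn] at h
  exact ⟨n, h⟩

variable (ℓ)

theorem exists_ringHom_pi_matrix_witt (r : ℕ) (nn ff : Fin r → ℕ) :
    ∃ ρ : ((i : Fin r) → Matrix (Fin (nn i)) (Fin (nn i)) (WittVector ℓ (GaloisField ℓ (ff i)))) →+*
      ((i : Fin r) → Matrix (Fin (nn i)) (Fin (nn i)) (GaloisField ℓ (ff i))),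
      Function.Surjective ρ ∧ (∀ x, ρ x = 0 ↔ ∃ y, x = (ℓ : ℕ) • y) := by
  refine ⟨RingHom.pi fun i => (WittVector.constantCoeff.mapMatrix).comp (Pi.evalRingHom _ i),
    fun q => ?_, fun x => ?_⟩
  · refine ⟨fun i => Matrix.of fun a b => WittVector.teichmuller ℓ (q i a b), ?_⟩
    ext i a b
    simp [WittVector.constantCoeff_apply]
  · have h : ∀ i (w : WittVector ℓ (GaloisField ℓ (ff i))),
        WittVector.constantCoeff w = 0 ↔ ∃ y, w = ℓ • y := fun i w => by
      rw [WittVector.constantCoeff_apply, ← WittVector.mem_span_p_iff_coeff_zero_eq_zero,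
        Ideal.mem_span_singleton]
      simp [Dvd.dvd, nsmul_eq_mul]
    constructor
    · intro hx
      have : ∀ i a b, ∃ y, x i a b = ℓ • y := fun i a b => by
        rw [← h]
        exact congrFun (congrFun (congrFun hx i) a) b
      choose y hy using this
      refine ⟨fun i => Matrix.of (y i), ?_⟩
      ext1 i
      ext1 a b
      exact hy i a b
    · rintro ⟨y, rfl⟩
      ext i a b
      exact (h i _).2 ⟨_, rfl⟩

end Residue

section Lift

variable {ℓ : ℕ} [Fact ℓ.Prime]

/-- A finite free `ℤ_ℓ`-algebra whose reduction modulo `ℓ` is semisimple is a product of matrix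
rings over Witt vectors of finite fields. -/
theorem exists_ringEquiv_pi_matrix_witt {Λ : Type} [Ring Λ] [Algebra ℤ_[ℓ] Λ]
    [Module.Free ℤ_[ℓ] Λ] [Module.Finite ℤ_[ℓ] Λ]
    (h : ∀ x : Λ, (∀ y, ∃ n ≠ 0, ∃ w, (y * x) ^ n = (ℓ : ℤ_[ℓ]) • w) →
      ∃ w, x = (ℓ : ℤ_[ℓ]) • w) :
    ∃ (r : ℕ) (nn ff : Fin r → ℕ), (∀ i, 0 < nn i) ∧ (∀ i, 0 < ff i) ∧ Nonempty (Λ ≃+*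
      ((i : Fin r) → Matrix (Fin (nn i)) (Fin (nn i)) (WittVector ℓ (GaloisField ℓ (ff i))))) := by
  classical
  let I : Ideal Λ := Ideal.span {(ℓ : Λ)}
  have hI : ∀ x, x ∈ I ↔ ∃ w, x = (ℓ : ℤ_[ℓ]) • w := fun x => by
    rw [Ideal.mem_span_singleton']
    refine exists_congr fun w => ?_
    rw [Algebra.smul_def, map_natCast, Nat.cast_comm, eq_comm]
  have : I.IsTwoSided := ⟨fun {a} b ha => by
    rw [hI] at ha ⊢
    obtain ⟨w, rfl⟩ := ha
    exact ⟨w * b, smul_mul_assoc _ _ _⟩⟩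
  let A := Λ ⧸ I
  let mk : Λ →+* A := Ideal.Quotient.mk I
  have hmk : Function.Surjective mk := Ideal.Quotient.mk_surjective
  have hmk0 : ∀ x, mk x = 0 ↔ ∃ w, x = (ℓ : ℤ_[ℓ]) • w := fun x => by
    rw [← hI]; exact Ideal.Quotient.eq_zero_iff_mem
  have hA : (ℓ : A) = 0 := by
    rw [← map_natCast mk, hmk0]
    exact ⟨1, by rw [Algebra.smul_def, map_natCast, mul_one]⟩
  have hapx : ∀ c : ℤ_[ℓ], ∃ d, c = ((PadicInt.toZMod c).val : ℤ_[ℓ]) + ℓ * d := fun c => by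
    obtain ⟨d, hd⟩ := (PadicInt.toZMod_eq_zero_iff
      (c - ((PadicInt.toZMod c).val : ℤ_[ℓ]))).1
      (by rw [map_sub, map_natCast, ZMod.natCast_zmod_val, sub_self])
    exact ⟨d, by rw [← hd]; ring⟩
  have : Finite A := by
    let b := Module.Free.chooseBasis ℤ_[ℓ] Λ
    refine Finite.of_surjective
      (fun c : _ → ZMod ℓ => mk (∑ i, ((c i).val : ℤ_[ℓ]) • b i)) fun q => ?_
    obtain ⟨x, rfl⟩ := hmk q
    refine ⟨fun i => PadicInt.toZMod (b.repr x i), ?_⟩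
    choose d hd using fun i => hapx (b.repr x i)
    rw [eq_comm, ← sub_eq_zero, ← map_sub, hmk0]
    refine ⟨∑ i, d i • b i, ?_⟩
    nth_rewrite 1 [← b.sum_repr x]
    rw [← Finset.sum_sub_distrib, Finset.smul_sum]
    refine Finset.sum_congr rfl fun i _ => ?_
    rw [← sub_smul, smul_smul]
    exact congrArg (· • b i) (sub_eq_iff_eq_add'.2 (hd i))
  have hJ : Ring.jacobson A = ⊥ := by
    refine (Submodule.eq_bot_iff _).2 fun a ha => ?_
    obtain ⟨x, rfl⟩ := hmk a
    refine (hmk0 x).2 (h x fun y => ?_)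
    obtain ⟨n, hn⟩ := isNilpotent_of_mem_jacobson ((Ring.jacobson A).mul_mem_left (mk y) ha)
    refine ⟨n + 1, n.succ_ne_zero, (hmk0 _).1 ?_⟩
    rw [map_pow, map_mul, pow_succ, hn, zero_mul]
  obtain ⟨r, nn, ff, hnn, hff, ⟨e⟩⟩ := exists_ringEquiv_pi_matrix_galoisField A hA hJ
  refine ⟨r, nn, ff, hnn, hff, ?_⟩
  have : ∀ i, Finite (GaloisField ℓ (ff i)) := fun i => inferInstance
  let : ∀ i, Algebra ℤ_[ℓ] (WittVector ℓ (GaloisField ℓ (ff i))) := fun i => wittAlgebra ℓ _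
  have := padicInt_isAdicComplete ℓ
  have := fun i => witt_finite ℓ (GaloisField ℓ (ff i))
  have := fun i => witt_free ℓ (GaloisField ℓ (ff i))
  have := fun i => witt_unramified ℓ (GaloisField ℓ (ff i))
  have : ∀ i, Nonempty (Fin (nn i)) := fun i => ⟨⟨0, hnn i⟩⟩
  obtain ⟨σ, hσ⟩ := exists_isSeparabilityElement_pi (R := ℤ_[ℓ]) fun i =>
    exists_isSeparabilityElement_matrix (n := Fin (nn i))
      (exists_isSeparabilityElement_of_formallyUnramified ℤ_[ℓ]
        (WittVector ℓ (GaloisField ℓ (ff i))))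
  obtain ⟨ρ, hρ, hρ0⟩ := exists_ringHom_pi_matrix_witt ℓ r nn ff
  have hℓ : (ℓ : ℤ_[ℓ]) ≠ 0 := PadicInt.prime_p.ne_zero
  let π := e.toRingHom.comp mk
  have hπ0 : ∀ x, π x = 0 ↔ ∃ w, x = (ℓ : ℤ_[ℓ]) • w := fun x => by
    rw [← hmk0]
    exact map_eq_zero_iff e e.injective
  have hρ0' : ∀ x, ρ x = 0 ↔ ∃ w, x = (ℓ : ℤ_[ℓ]) • w := fun x => by
    rw [hρ0]
    simp_rw [Nat.cast_smul_eq_nsmul]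
  obtain ⟨g⟩ := nonempty_algEquiv_of_mod (p := (ℓ : ℤ_[ℓ])) hσ
    (fun z hz => (smul_eq_zero.1 hz).resolve_left hℓ) π (e.surjective.comp hmk) hπ0 ρ hρ hρ0'
    fun c => by
      obtain ⟨d, hd⟩ := hapx c
      have h1 := (hπ0 (algebraMap ℤ_[ℓ] Λ (ℓ * d))).2
        ⟨algebraMap _ _ d, by rw [Algebra.smul_def, map_mul]⟩
      have h2 := (hρ0' (algebraMap ℤ_[ℓ] _ (ℓ * d))).2
        ⟨algebraMap _ _ d, by rw [Algebra.smul_def, map_mul]⟩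
      rw [hd, map_add, map_add, map_add, map_add, h1, h2, map_natCast, map_natCast, map_natCast,
        map_natCast]
  exact ⟨g.symm.toRingEquiv⟩

end Lift

section Order

variable {ℓ : ℕ} [Fact ℓ.Prime] {B : Type} [Ring B] [Algebra ℚ_[ℓ] B] [Algebra ℤ_[ℓ] B]
  [IsScalarTower ℤ_[ℓ] ℚ_[ℓ] B] {t : B →ₗ[ℚ_[ℓ]] ℚ_[ℓ]} {Λ : Subalgebra ℤ_[ℓ] B}
  [Module.Free ℤ_[ℓ] Λ] [Module.Finite ℤ_[ℓ] Λ] {T : Λ → Λ → ℤ_[ℓ]}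

theorem not_dvd_gramDet_iff_of_trace
    (hT : ∀ x y : Λ, ((T x y : ℤ_[ℓ]) : ℚ_[ℓ]) = t ((x : B) * (y : B))) :
    ¬ (ℓ : ℤ_[ℓ]) ∣ gramDet ℤ_[ℓ] ℤ_[ℓ] T ↔
      ∀ x, (∀ y, (ℓ : ℤ_[ℓ]) ∣ T x y) → ∃ y, x = (ℓ : ℤ_[ℓ]) • y := by
  have hsmul : ∀ (c : ℤ_[ℓ]) (x : B), t (c • x) = (c : ℚ_[ℓ]) * t x := fun c x => by
    rw [← algebraMap_smul ℚ_[ℓ] c x, map_smul, smul_eq_mul, PadicInt.algebraMap_apply]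
  let Tb : Λ →ₗ[ℤ_[ℓ]] Λ →ₗ[ℤ_[ℓ]] ℤ_[ℓ] := LinearMap.mk₂ ℤ_[ℓ] T
    (fun x y z => Subtype.ext (by push_cast; simp only [hT]; push_cast; rw [add_mul, map_add]))
    (fun c x y => Subtype.ext (by
      rw [smul_eq_mul]; push_cast; simp only [hT]; push_cast; rw [smul_mul_assoc, hsmul]))
    (fun x y z => Subtype.ext (by push_cast; simp only [hT]; push_cast; rw [mul_add, map_add]))
    (fun c x y => Subtype.ext (by
      rw [smul_eq_mul]; push_cast; simp only [hT]; push_cast; rw [mul_smul_comm, hsmul]))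
  exact not_dvd_gramDet_iff Tb

theorem exists_ringEquiv_of_not_dvd_gramDet (ht : IsReducedTrace ℚ_[ℓ] B t)
    (hT : ∀ x y : Λ, ((T x y : ℤ_[ℓ]) : ℚ_[ℓ]) = t ((x : B) * (y : B)))
    (h : ¬ (ℓ : ℤ_[ℓ]) ∣ gramDet ℤ_[ℓ] ℤ_[ℓ] T) :
    ∃ (r : ℕ) (nn ff : Fin r → ℕ), (∀ i, 0 < nn i) ∧ (∀ i, 0 < ff i) ∧ Nonempty (Λ ≃+*
      ((i : Fin r) → Matrix (Fin (nn i)) (Fin (nn i)) (WittVector ℓ (GaloisField ℓ (ff i))))) := by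
  rw [not_dvd_gramDet_iff_of_trace hT] at h
  refine exists_ringEquiv_pi_matrix_witt fun x hx => h x fun y => ?_
  obtain ⟨n, hn, w, hw⟩ := hx y
  refine ht.dvd_of_pow_eq (w := (w : B)) (z := (y : B) * x) hn
    ((IsIntegral.of_finite ℤ_[ℓ] w).map Λ.val) ?_ ((hT x y).trans (ht.mul_comm _ _))
  have := congrArg (fun z : Λ => (z : B)) hw
  push_cast at this
  rw [this, ← algebraMap_smul ℚ_[ℓ] (ℓ : ℤ_[ℓ]), map_natCast]

end Order

section MatrixTrace

theorem trace_mulLeftRight_pi_matrix {Ω ι : Type*} [Field Ω] [Fintype ι] {n : ι → Type*}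
    [∀ i, Fintype (n i)] [∀ i, DecidableEq (n i)] (z p : ∀ i, Matrix (n i) (n i) Ω) :
    LinearMap.trace Ω (∀ i, Matrix (n i) (n i) Ω) (LinearMap.mulLeftRight Ω (z, p)) =
      ∑ i, (z i).trace * (p i).trace := by
  classical
  rw [LinearMap.trace_eq_matrix_trace Ω (Pi.basis fun i => Matrix.stdBasis Ω (n i) (n i)),
    Matrix.trace, Fintype.sum_sigma]
  refine Finset.sum_congr rfl fun i _ => ?_
  rw [Fintype.sum_prod_type, Matrix.trace, Matrix.trace, Finset.sum_mul_sum]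
  refine Finset.sum_congr rfl fun a _ => Finset.sum_congr rfl fun b _ => ?_
  have h : ∀ (M : Matrix (n i) (n i) Ω), (Matrix.stdBasis Ω (n i) (n i)).repr M (a, b) = M a b :=
    fun M => rfl
  simp [LinearMap.toMatrix_apply, Pi.basis_repr, h, Matrix.stdBasis_eq_single, Matrix.mul_apply,
    Matrix.single_apply, ite_and, Finset.sum_ite_eq]

/-- A nonzero idempotent matrix whose corner ring is commutative has trace one. -/
theorem Matrix.trace_eq_one_of_isIdempotentElem {Ω n : Type*} [Field Ω]
    [Fintype n] [DecidableEq n]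
    {p : Matrix n n Ω} (hp : p * p = p) (hp0 : p ≠ 0)
    (hc : ∀ x y, p * x * p * (p * y * p) = p * y * p * (p * x * p)) : p.trace = 1 := by
  have key : ∀ i k l m r j, p i k * p l m * p r j = p i m * p r k * p l j := fun i k l m r j => by
    have h : ∀ x y, p * x * p * (p * y * p) = p * x * p * y * p := fun x y => by
      simp only [← Matrix.mul_assoc]
      rw [Matrix.mul_assoc (p * x) p p, hp]
    have := congrFun (congrFun (hc (Matrix.single k l 1) (Matrix.single m r 1)) i) j
    rw [h, h] at this
    simpa [Matrix.mul_apply, Matrix.single_apply, ite_and, Finset.sum_ite_eq] using this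
  have hpij : ∀ i j, ∑ k, p i k * p k j = p i j := fun i j => by
    rw [← Matrix.mul_apply, hp]
  have h1 : ∀ i k r j, p i k * p.trace * p r j = p i j * p r k := fun i k r j => by
    rw [Matrix.trace, Finset.mul_sum, Finset.sum_mul, ← hpij i j, Finset.sum_mul]
    exact Finset.sum_congr rfl fun l _ => by rw [Matrix.diag_apply, key]; ring
  obtain ⟨i, j, hij⟩ : ∃ i j, p i j ≠ 0 := by
    by_contra! h
    exact hp0 (Matrix.ext h)
  have h2 := h1 i j i j
  have h3 : p i j * p i j ≠ 0 := mul_ne_zero hij hij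
  refine mul_right_cancel₀ h3 ?_
  linear_combination h2

end MatrixTrace

section Corner

variable {ℓ : ℕ} [Fact ℓ.Prime] {B : Type} [Ring B] [Algebra ℚ_[ℓ] B] [Algebra ℤ_[ℓ] B]
  [IsScalarTower ℤ_[ℓ] ℚ_[ℓ] B] {t : B →ₗ[ℚ_[ℓ]] ℚ_[ℓ]} {Λ : Subalgebra ℤ_[ℓ] B}

/-- A `ℤ_ℓ`-basis of an order is a basis of the ambient algebra. -/
theorem exists_basis_of_span_eq_top (hspan : Submodule.span ℚ_[ℓ] (Λ : Set B) = ⊤)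
    {ι : Type*} (b : Module.Basis ι ℤ_[ℓ] Λ) :
    ∃ c : Module.Basis ι ℚ_[ℓ] B, ∀ i, c i = b i := by
  have hli : LinearIndependent ℚ_[ℓ] fun i => (b i : B) :=
    (LinearIndependent.iff_fractionRing ℤ_[ℓ] ℚ_[ℓ]).1
      (b.linearIndependent.map' Λ.val.toLinearMap (LinearMap.ker_eq_bot.2 Subtype.val_injective))
  have hsp : ⊤ ≤ Submodule.span ℚ_[ℓ] (Set.range fun i => (b i : B)) := by
    rw [← hspan, Submodule.span_le]
    intro x hx
    have h1 : (⟨x, hx⟩ : Λ) ∈ Submodule.span ℤ_[ℓ] (Set.range b) := b.span_eq ▸ trivial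
    have h2 := Submodule.mem_map_of_mem (f := Λ.val.toLinearMap) h1
    rw [Submodule.map_span, ← Set.range_comp] at h2
    exact Submodule.span_subset_span ℤ_[ℓ] ℚ_[ℓ] _ h2
  exact ⟨Module.Basis.mk hli hsp, fun i => Module.Basis.mk_apply hli hsp i⟩

variable [Module.Free ℤ_[ℓ] Λ] [Module.Finite ℤ_[ℓ] Λ]

/-- For an idempotent `p` of an order whose corner ring is commutative, the reduced trace of an
element of the corner is the trace of its action on the order. -/
theorem IsReducedTrace.eq_trace_mulLeftRight (ht : IsReducedTrace ℚ_[ℓ] B t)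
    (hspan : Submodule.span ℚ_[ℓ] (Λ : Set B) = ⊤) {z p : Λ} (hp : p * p = p) (hz : p * z = z)
    (hc : ∀ x y, p * x * p * (p * y * p) = p * y * p * (p * x * p)) :
    t (z : B) = (LinearMap.trace ℤ_[ℓ] Λ (LinearMap.mulLeftRight ℤ_[ℓ] (z, p)) : ℚ_[ℓ]) := by
  classical
  obtain ⟨m, n, e, he⟩ := ht
  let Ω := AlgebraicClosure ℚ_[ℓ]
  let P := (i : Fin m) → Matrix (Fin (n i)) (Fin (n i)) Ω
  let b := Module.Free.chooseBasis ℤ_[ℓ] Λ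
  obtain ⟨c, hcb⟩ := exists_basis_of_span_eq_top hspan b
  let b' : Module.Basis _ Ω P := (Algebra.TensorProduct.basis Ω c).map e.toLinearEquiv
  let φ : B →ₐ[ℚ_[ℓ]] P :=
    (e.toAlgHom.restrictScalars ℚ_[ℓ]).comp Algebra.TensorProduct.includeRight
  have hb' : ∀ i, b' i = φ (b i) := fun i => by
    simp [b', φ, hcb]
  have hrepr : ∀ (x : Λ) i, b'.repr (φ x) i = algebraMap ℤ_[ℓ] Ω (b.repr x i) := fun x i => by
    have h1 : φ x = ∑ j, algebraMap ℤ_[ℓ] Ω (b.repr x j) • b' j := by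
      conv_lhs => rw [← b.sum_repr x]
      rw [AddSubmonoidClass.coe_finsetSum, map_sum]
      refine Finset.sum_congr rfl fun j _ => ?_
      rw [hb', Subalgebra.coe_smul, ← algebraMap_smul ℚ_[ℓ] (b.repr x j), map_smul,
        ← algebraMap_smul Ω (algebraMap ℤ_[ℓ] ℚ_[ℓ] (b.repr x j)),
        ← IsScalarTower.algebraMap_apply]
    rw [h1, b'.repr_sum_self]
  have htr : algebraMap ℤ_[ℓ] Ω (LinearMap.trace ℤ_[ℓ] Λ (LinearMap.mulLeftRight ℤ_[ℓ] (z, p))) =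
      LinearMap.trace Ω P (LinearMap.mulLeftRight Ω (φ z, φ p)) := by
    rw [LinearMap.trace_eq_matrix_trace ℤ_[ℓ] b, LinearMap.trace_eq_matrix_trace Ω b',
      Matrix.trace, Matrix.trace, map_sum]
    refine Finset.sum_congr rfl fun i _ => ?_
    rw [Matrix.diag_apply, Matrix.diag_apply, LinearMap.toMatrix_apply, LinearMap.toMatrix_apply,
      LinearMap.mulLeftRight_apply, LinearMap.mulLeftRight_apply, hb', ← map_mul, ← map_mul,
      ← hrepr]
    push_cast
    rfl
  have hcP : ∀ x y : P, φ p * x * φ p * (φ p * y * φ p) = φ p * y * φ p * (φ p * x * φ p) := by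
    let μ : P →ₗ[Ω] P →ₗ[Ω] P := (LinearMap.mul Ω P).compl₁₂
      (LinearMap.mulLeftRight Ω (φ p, φ p)) (LinearMap.mulLeftRight Ω (φ p, φ p))
    have h1 : μ = μ.flip := b'.ext fun i => b'.ext fun j => by
      simp only [μ, LinearMap.compl₁₂_apply, LinearMap.flip_apply, LinearMap.mulLeftRight_apply,
        LinearMap.mul_apply', hb', ← map_mul]
      exact congrArg φ (congrArg Subtype.val (hc (b i) (b j)))
    exact fun x y => congrArg (fun ν => ν x y) h1
  have hpP : φ p * φ p = φ p := by
    rw [← map_mul]; exact congrArg φ (congrArg Subtype.val hp)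
  have hzP : φ p * φ z = φ z := by
    rw [← map_mul]; exact congrArg φ (congrArg Subtype.val hz)
  apply (algebraMap ℚ_[ℓ] Ω).injective
  rw [he, ← PadicInt.algebraMap_apply, ← IsScalarTower.algebraMap_apply, htr,
    trace_mulLeftRight_pi_matrix]
  refine Finset.sum_congr rfl fun i _ => ?_
  change (φ z i).trace = _
  by_cases h0 : φ p i = 0
  · have h1 := congrFun hzP i
    rw [Pi.mul_apply, h0, zero_mul] at h1
    rw [← h1, Matrix.trace_zero, zero_mul]
  · rw [Matrix.trace_eq_one_of_isIdempotentElem (congrFun hpP i) h0 fun x y => ?_, mul_one]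
    have h1 : ∀ w, (Pi.single i w : P) i = w := fun w =>
      Pi.single_eq_same (M := fun i => Matrix (Fin (n i)) (Fin (n i)) Ω) i w
    have h2 := congrFun (hcP (Pi.single i x) (Pi.single i y)) i
    simpa only [Pi.mul_apply (M := fun i => Matrix (Fin (n i)) (Fin (n i)) Ω),
      h1] using h2

end Corner

section MatrixWitt

variable {ℓ : ℕ} [Fact ℓ.Prime]

theorem map_algebraMap_padicInt {Λ M : Type*} [Ring Λ] [Algebra ℤ_[ℓ] Λ] [Ring M]
    [Algebra ℤ_[ℓ] M] [Module.Free ℤ_[ℓ] M] [Module.Finite ℤ_[ℓ] M] (f : Λ →+* M) (c : ℤ_[ℓ]) :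
    f (algebraMap ℤ_[ℓ] Λ c) = algebraMap ℤ_[ℓ] M c := by
  have := padicInt_isAdicComplete ℓ
  have := isAdicComplete_of_free_of_finite (N := M) (ℓ : ℤ_[ℓ])
  rw [← sub_eq_zero]
  refine IsHausdorff.haus (inferInstance : IsHausdorff (Ideal.span {(ℓ : ℤ_[ℓ])}) M) _
    fun n => SModEq.zero.2 (mem_span_pow_smul_top_iff.2 ?_)
  obtain ⟨d, hd⟩ := Ideal.mem_span_singleton.1 (PadicInt.appr_spec n c)
  refine ⟨f (algebraMap _ _ d) - algebraMap _ _ d, ?_⟩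
  rw [sub_eq_iff_eq_add'] at hd
  conv_lhs => rw [hd]
  simp only [map_add, map_mul, map_pow, map_natCast, Algebra.smul_def, mul_sub]
  abel

/-- The trace of the action of a corner element on a product of matrix rings. -/
theorem trace_mulLeftRight_single {R ι : Type*} [CommRing R] [Fintype ι] [DecidableEq ι]
    {n : ι → Type*} [∀ i, Fintype (n i)] [∀ i, DecidableEq (n i)] {S : ι → Type*}
    [∀ i, CommRing (S i)] [∀ i, Algebra R (S i)] [∀ i, Module.Free R (S i)]
    [∀ i, Module.Finite R (S i)] (i : ι) (a : n i) (w : S i) :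
    LinearMap.trace R (∀ i, Matrix (n i) (n i) (S i)) (LinearMap.mulLeftRight R
      (Pi.single i (Matrix.single a a w), Pi.single i (Matrix.single a a 1))) =
      Algebra.trace R (S i) w := by
  let α : S i →ₗ[R] ∀ i, Matrix (n i) (n i) (S i) :=
    LinearMap.single R (fun i => Matrix (n i) (n i) (S i)) i ∘ₗ Matrix.singleLinearMap R a a
  let β : (∀ i, Matrix (n i) (n i) (S i)) →ₗ[R] S i :=
    Matrix.entryLinearMap R (S i) a a ∘ₗ LinearMap.proj i
  have h1 : LinearMap.mulLeftRight R
      (Pi.single i (Matrix.single a a w), Pi.single i (Matrix.single a a 1)) =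
      α ∘ₗ (Algebra.lmul R (S i) w ∘ₗ β) := by
    refine LinearMap.ext fun y => funext fun j => ?_
    rw [LinearMap.mulLeftRight_apply]
    rcases eq_or_ne j i with rfl | hj
    · simp [α, β, Matrix.single_mul_mul_single]
    · simp [α, β, hj]
  rw [h1, LinearMap.trace_comp_comm', Algebra.trace_apply]
  congr 1
  ext1 y
  simp [α, β]

theorem WittVector.dvd_or_isUnit {k : Type*} [Field k] [CharP k ℓ] [PerfectRing k ℓ]
    (w : WittVector ℓ k) : (∃ v, w = ℓ * v) ∨ IsUnit w := by
  by_cases h : w.coeff 0 = 0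
  · exact .inl (Ideal.mem_span_singleton.1 (WittVector.mem_span_p_iff_coeff_zero_eq_zero w |>.2 h))
  · exact .inr (WittVector.isUnit_of_coeff_zero_ne_zero w h)

end MatrixWitt

section Order

theorem Pi.single_matrixSingle_mul_mul_single {ι : Type*} [DecidableEq ι] {n : ι → Type*}
    [∀ i, Fintype (n i)] [∀ i, DecidableEq (n i)] {S : ι → Type*} [∀ i, Semiring (S i)]
    (x : ∀ i, Matrix (n i) (n i) (S i)) (i : ι) (a b c d : n i) (w v : S i) :
    Pi.single i (Matrix.single a b w) * x * Pi.single i (Matrix.single c d v) =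
      Pi.single i (Matrix.single a d (w * x i b c * v)) := by
  funext j
  rcases eq_or_ne j i with rfl | hj
  · simp [Matrix.single_mul_mul_single]
  · simp [hj]

variable {ℓ : ℕ} [Fact ℓ.Prime] {B : Type} [Ring B] [Algebra ℚ_[ℓ] B] [Algebra ℤ_[ℓ] B]
  [IsScalarTower ℤ_[ℓ] ℚ_[ℓ] B] {t : B →ₗ[ℚ_[ℓ]] ℚ_[ℓ]} {Λ : Subalgebra ℤ_[ℓ] B}
  [Module.Free ℤ_[ℓ] Λ] [Module.Finite ℤ_[ℓ] Λ] {T : Λ → Λ → ℤ_[ℓ]}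

theorem not_dvd_gramDet_of_algEquiv (ht : IsReducedTrace ℚ_[ℓ] B t)
    (hspan : Submodule.span ℚ_[ℓ] (Λ : Set B) = ⊤)
    (hT : ∀ x y : Λ, ((T x y : ℤ_[ℓ]) : ℚ_[ℓ]) = t ((x : B) * (y : B)))
    {ι : Type*} [Fintype ι] {n : ι → Type*} [∀ i, Fintype (n i)] [∀ i, DecidableEq (n i)]
    {S : ι → Type*} [∀ i, CommRing (S i)] [∀ i, Algebra ℤ_[ℓ] (S i)]
    [∀ i, Module.Free ℤ_[ℓ] (S i)] [∀ i, Module.Finite ℤ_[ℓ] (S i)]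
    (hS : ∀ i (w : S i), (∃ v, w = ℓ * v) ∨ IsUnit w)
    (htr : ∀ i, ∃ w : S i, IsUnit (Algebra.trace ℤ_[ℓ] (S i) w))
    (φ : Λ ≃ₐ[ℤ_[ℓ]] ((i : ι) → Matrix (n i) (n i) (S i))) :
    ¬ (ℓ : ℤ_[ℓ]) ∣ gramDet ℤ_[ℓ] ℤ_[ℓ] T := by
  classical
  let s : ∀ i, n i → n i → S i → Λ := fun i a b w => φ.symm (Pi.single i (Matrix.single a b w))
  have hs : ∀ i a b c d (w : S i) (x : Λ) v,
      s i a b w * x * s i c d v = s i a d (w * φ x i b c * v) := fun i a b c d w x v => by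
    apply φ.injective
    simp only [s, map_mul, AlgEquiv.apply_symm_apply, Pi.single_matrixSingle_mul_mul_single]
  have hs' : ∀ i a b d (w v : S i), s i a b w * s i b d v = s i a d (w * v) :=
      fun i a b d w v => by
    apply φ.injective
    simp only [s, map_mul, AlgEquiv.apply_symm_apply]
    rw [← Pi.single_mul, Matrix.single_mul_single_same]
  have ht' : ∀ i a w, t (s i a a w : B) = (Algebra.trace ℤ_[ℓ] (S i) w : ℚ_[ℓ]) := fun i a w => by
    rw [ht.eq_trace_mulLeftRight hspan (z := s i a a w) (p := s i a a 1)
      (by rw [hs', mul_one]) (by rw [hs', one_mul])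
      (fun x y => by simp only [hs, hs', one_mul, mul_one]; rw [mul_comm]),
      ← trace_mulLeftRight_single (n := n) i a w, ← LinearMap.trace_conj' _ φ.toLinearEquiv]
    congr 2
    refine LinearMap.ext fun y => ?_
    simp [LinearEquiv.conj_apply, s]
  rw [not_dvd_gramDet_iff_of_trace hT]
  intro x hx
  have hdvd : ∀ i a b, ∃ v : S i, φ x i a b = ℓ * v := fun i a b => by
    refine (hS i (φ x i a b)).resolve_right ?_
    rintro ⟨u, hu⟩
    obtain ⟨w, hw⟩ := htr i
    have h1 : T x (s i b a (↑u⁻¹ * w) * s i a a 1) = Algebra.trace ℤ_[ℓ] (S i) w := by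
      apply Subtype.val_injective
      have h2 : s i a a 1 * x * s i b a (↑u⁻¹ * w) = s i a a w := by
        rw [hs, ← hu, one_mul, Units.mul_inv_cancel_left]
      rw [← ht' i a w, ← h2, hT]
      push_cast
      rw [← mul_assoc, ht.mul_comm, ← mul_assoc]
    exact PadicInt.prime_p.not_isUnit (isUnit_of_dvd_unit (h1 ▸ hx _) hw)
  choose v hv using hdvd
  refine ⟨φ.symm fun i => Matrix.of (v i), φ.injective ?_⟩
  rw [map_smul, AlgEquiv.apply_symm_apply]
  funext i
  ext a b : 2
  rw [hv, Pi.smul_apply, Matrix.smul_apply, Algebra.smul_def, map_natCast, Matrix.of_apply]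

theorem not_dvd_gramDet_of_ringEquiv (ht : IsReducedTrace ℚ_[ℓ] B t)
    (hspan : Submodule.span ℚ_[ℓ] (Λ : Set B) = ⊤)
    (hT : ∀ x y : Λ, ((T x y : ℤ_[ℓ]) : ℚ_[ℓ]) = t ((x : B) * (y : B)))
    {r : ℕ} {nn ff : Fin r → ℕ}
    (g : Λ ≃+*
      ((i : Fin r) → Matrix (Fin (nn i)) (Fin (nn i)) (WittVector ℓ (GaloisField ℓ (ff i))))) :
    ¬ (ℓ : ℤ_[ℓ]) ∣ gramDet ℤ_[ℓ] ℤ_[ℓ] T := by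
  let : ∀ i, Algebra ℤ_[ℓ] (WittVector ℓ (GaloisField ℓ (ff i))) := fun i => wittAlgebra ℓ _
  have := fun i => witt_finite ℓ (GaloisField ℓ (ff i))
  have := fun i => witt_free ℓ (GaloisField ℓ (ff i))
  have := fun i => witt_unramified ℓ (GaloisField ℓ (ff i))
  have := fun i => witt_isLocalHom ℓ (GaloisField ℓ (ff i))
  exact not_dvd_gramDet_of_algEquiv ht hspan hT (fun i => WittVector.dvd_or_isUnit)
    (fun i => exists_isUnit_trace ℤ_[ℓ] _)
    (AlgEquiv.ofRingEquiv (f := g) (map_algebraMap_padicInt g.toRingHom))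

end Order

/-- let `ℓ` be a prime and `Λ` an order in a semisimple `ℚ_ℓ`-algebra `B`. Then
`ℓ` does not divide the discriminant of `Λ` (with respect to the reduced trace form) if and
only if `Λ` is isomorphic, as a ring, to a finite direct product of matrix algebras
`Mat_{n_i}(O_{k_i})` where each `O_{k_i}` is the ring of integers of a finite unramified
extension `k_i/ℚ_ℓ`, i.e. the ring of Witt vectors `W(𝔽_{ℓ^{f_i}})` with `f_i ≥ 1`. -/
theorem stmt7 (ℓ : ℕ) [Fact ℓ.Prime]
    (B : Type) [Ring B] [Algebra ℚ_[ℓ] B] [FiniteDimensional ℚ_[ℓ] B] [IsSemisimpleRing B]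
    [Algebra ℤ_[ℓ] B] [IsScalarTower ℤ_[ℓ] ℚ_[ℓ] B]
    (t : B →ₗ[ℚ_[ℓ]] ℚ_[ℓ]) (ht : IsReducedTrace ℚ_[ℓ] B t)
    (Λ : Subalgebra ℤ_[ℓ] B) [Module.Free ℤ_[ℓ] Λ] [Module.Finite ℤ_[ℓ] Λ]
    (hspan : Submodule.span ℚ_[ℓ] (Λ : Set B) = ⊤)
    (T : Λ → Λ → ℤ_[ℓ])
    (hT : ∀ x y : Λ, ((T x y : ℤ_[ℓ]) : ℚ_[ℓ]) = t ((x : B) * (y : B))) :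
    ¬ ((ℓ : ℤ_[ℓ]) ∣ gramDet ℤ_[ℓ] ℤ_[ℓ] T) ↔
      ∃ (r : ℕ) (nn ff : Fin r → ℕ), (∀ i, 0 < nn i) ∧ (∀ i, 0 < ff i) ∧
        Nonempty (Λ ≃+*
          ((i : Fin r) → Matrix (Fin (nn i)) (Fin (nn i)) (WittVector ℓ (GaloisField ℓ (ff i))))) := by
  refine ⟨exists_ringEquiv_of_not_dvd_gramDet ht hT, ?_⟩
  rintro ⟨r, nn, ff, -, -, ⟨g⟩⟩
  exact not_dvd_gramDet_of_ringEquiv ht hspan hT g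
end
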